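/- arXiv:1709.00602 — 2 statements merged into one kernel-verified Lean document; each statement's English description precedes it below -/
import Mathlib

section
/- Let v = (v₁,v₂) ∈ C₀^∞(P;ℝ²) and f ∈ C₀^∞(P;[0,∞)) with f > |v| on supp v. Then the vector field u[v,f] is divergence-free on ℝ³ if and only if div(x₂ v(x₁,x₂)) = 0 for all (x₁,x₂) ∈ P. -/
noncomputable section

open MeasureTheory Real Set Filter Topology

abbrev E3 : Type := EuclideanSpace ℝ (Fin 3)

/-- The point of `ℝ³` with coordinates `(a, b, c)`. -/
def e3 (a b c : ℝ) : E3 := (EuclideanSpace.equiv (Fin 3) ℝ).symm ![a, b, c]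

/-- Spatial partial derivative `∂ᵢ w`. -/
def pd3 (w : E3 → ℝ) (i : Fin 3) (x : E3) : ℝ := fderiv ℝ w x (EuclideanSpace.single i 1)

/-- Laplacian of a scalar function on `ℝ³`. -/
def lap3 (w : E3 → ℝ) (x : E3) : ℝ := ∑ i : Fin 3, pd3 (fun y => pd3 w i y) i x

/-- Divergence of a vector field on `ℝ³`. -/
def div3 (u : E3 → E3) (x : E3) : ℝ := ∑ i : Fin 3, pd3 (fun y => u y i) i x

/-- `|∇u|²`. -/
def gradsq (u : E3 → E3) (x : E3) : ℝ :=
  ∑ i : Fin 3, ∑ j : Fin 3, (pd3 (fun y => u y j) i x) ^ 2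

/-- The pressure function corresponding to a vector field `u`. -/
def pressureFn (u : E3 → E3) (x : E3) : ℝ :=
  ∫ y : E3, (∑ i : Fin 3, ∑ j : Fin 3,
    pd3 (fun z => u z j) i y * pd3 (fun z => u z i) j y) / (4 * π * ‖x - y‖)

/-- Rotation about the `x₁` axis by angle `θ`. -/
def rot3 (θ : ℝ) (x : E3) : E3 :=
  e3 (x 0) (x 1 * Real.cos θ - x 2 * Real.sin θ) (x 1 * Real.sin θ + x 2 * Real.cos θ)

abbrev Pt : Type := ℝ × ℝ

/-- The open upper half-plane `P`. -/
def Pset : Set Pt := {p | 0 < p.2}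

def pdx (g : Pt → ℝ) (p : Pt) : ℝ := fderiv ℝ g p (1, 0)

def pdy (g : Pt → ℝ) (p : Pt) : ℝ := fderiv ℝ g p (0, 1)

/-- The operator `L`, `Lg = Δg + ∂₂ g / x₂ - g / x₂²`. -/
def Lop (g : Pt → ℝ) (p : Pt) : ℝ :=
  (pdx (fun q => pdx g q) p + pdy (fun q => pdy g q) p) + pdy g p / p.2 - g p / p.2 ^ 2

/-- `div (x₂ v(x₁,x₂))` for a planar vector field `v = (w₁, w₂)`. -/
def div2w (w₁ w₂ : Pt → ℝ) (p : Pt) : ℝ :=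
  pdx (fun q => q.2 * w₁ q) p + pdy (fun q => q.2 * w₂ q) p

/-- `g ∈ C₀^∞(P)`. -/
def SmoothCompSuppP (g : Pt → ℝ) : Prop :=
  ContDiff ℝ (⊤ : ℕ∞) g ∧ HasCompactSupport g ∧ tsupport g ⊆ Pset

/-- Distance to the `x₁`-axis. -/
def rad (x : E3) : ℝ := Real.sqrt ((x 1) ^ 2 + (x 2) ^ 2)

/-- The cylindrical projection `R⁻¹`. -/
def Rinv (x : E3) : Pt := (x 0, rad x)

/-- The rotation `R(V)` of a subset `V` of the (closed) upper half-plane. -/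
def Rset (V : Set Pt) : Set E3 := {x | Rinv x ∈ V}

def wcomp (v₁ v₂ f : Pt → ℝ) (p : Pt) : ℝ := Real.sqrt (f p ^ 2 - (v₁ p ^ 2 + v₂ p ^ 2))

/-- The axisymmetric vector field `u[v,f]` determined (in cylindrical coordinates) by
`u[v,f](x₁,x₂,0) = (v₁(x₁,x₂), v₂(x₁,x₂), √(f(x₁,x₂)² − |v(x₁,x₂)|²))` for `x₂ ≥ 0`. -/
def uvf (v₁ v₂ f : Pt → ℝ) (x : E3) : E3 :=
  e3 (v₁ (Rinv x))
    (v₂ (Rinv x) * (x 1 / rad x) - wcomp v₁ v₂ f (Rinv x) * (x 2 / rad x))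
    (v₂ (Rinv x) * (x 2 / rad x) + wcomp v₁ v₂ f (Rinv x) * (x 1 / rad x))

/-- The planar pressure function `p[v,f]`, the restriction to `{x₃ = 0}` of the pressure
function `p*[v,f]` corresponding to `u[v,f]`. -/
def pvf (v₁ v₂ f : Pt → ℝ) (q : Pt) : ℝ := pressureFn (uvf v₁ v₂ f) (e3 q.1 q.2 0)

def zf : Pt → ℝ := fun _ => 0

/-- First component of the pressure interaction function `F[v,f] = ∇p[0,f] − ∇p[v,f]`. -/
def Fpi1 (v₁ v₂ f : Pt → ℝ) (q : Pt) : ℝ := pdx (pvf zf zf f) q - pdx (pvf v₁ v₂ f) q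

/-- Second component of the pressure interaction function `F[v,f] = ∇p[0,f] − ∇p[v,f]`. -/
def Fpi2 (v₁ v₂ f : Pt → ℝ) (q : Pt) : ℝ := pdy (pvf zf zf f) q - pdy (pvf v₁ v₂ f) q

/-- A structure `(v, f, φ)` (with `v = (w₁,w₂)`) on a set `U ⋐ P`. -/
structure StructureOn (U : Set Pt) (w₁ w₂ f φ : Pt → ℝ) : Prop where
  smooth_w₁ : ContDiff ℝ (⊤ : ℕ∞) w₁
  smooth_w₂ : ContDiff ℝ (⊤ : ℕ∞) w₂
  smooth_f : ContDiff ℝ (⊤ : ℕ∞) f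
  smooth_phi : ContDiff ℝ (⊤ : ℕ∞) φ
  hcs_w₁ : HasCompactSupport w₁
  hcs_w₂ : HasCompactSupport w₂
  hcs_f : HasCompactSupport f
  hcs_phi : HasCompactSupport φ
  supp_w₁ : tsupport w₁ ⊆ {p | φ p = 1}
  supp_w₂ : tsupport w₂ ⊆ {p | φ p = 1}
  supp_f : tsupport f = closure U
  f_nonneg : ∀ p, 0 ≤ f p
  phi_mem : ∀ p, φ p ∈ Icc (0:ℝ) 1
  supp_phi : tsupport φ ⊆ U
  div_v : ∀ p ∈ U, div2w w₁ w₂ p = 0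
  f_gt : ∀ p ∈ U, Real.sqrt (w₁ p ^ 2 + w₂ p ^ 2) < f p
  Lf_pos : ∀ p ∈ U, φ p ≠ 1 → 0 < Lop f p

/-- `u` is a weak solution of the Navier–Stokes inequality with viscosity `ν`:
the local energy inequality holds against every nonnegative test function
`φ ∈ C₀^∞(ℝ³ × (0,∞))`. -/
def IsWeakNSI (ν : ℝ) (u : E3 → ℝ → E3) : Prop :=
  ∀ φ : E3 × ℝ → ℝ, ContDiff ℝ (⊤ : ℕ∞) φ → HasCompactSupport φ →
    tsupport φ ⊆ {z : E3 × ℝ | 0 < z.2} → (∀ z, 0 ≤ φ z) →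
    2 * ν * (∫ t in Ioi (0:ℝ), ∫ x : E3, gradsq (fun y => u y t) x * φ (x, t)) ≤
      ∫ t in Ioi (0:ℝ), ∫ x : E3,
        (‖u x t‖ ^ 2 * (deriv (fun s => φ (x, s)) t + ν * lap3 (fun y => φ (y, t)) x)
          + (‖u x t‖ ^ 2 + 2 * pressureFn (fun y => u y t) x) *
              (∑ i : Fin 3, u x t i * pd3 (fun y => φ (y, t)) i x))

/-- The regularity `sup_{t>0} ‖u(t)‖_{L²} < ∞` and `∇u ∈ L²(ℝ³ × (0,∞))`. -/
def NSIRegular (u : E3 → ℝ → E3) : Prop :=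
  (∃ M : ℝ, ∀ t, 0 < t →
    Integrable (fun x : E3 => ‖u x t‖ ^ 2) ∧ (∫ x : E3, ‖u x t‖ ^ 2) ≤ M) ∧
  IntegrableOn (fun z : E3 × ℝ => gradsq (fun y => u y z.2) z.1) (univ ×ˢ Ioi 0)

/-- `u` is unbounded in every neighbourhood of `(x₀, T₀)`. -/
def UnboundedNear (u : E3 → ℝ → E3) (x₀ : E3) (T₀ : ℝ) : Prop :=
  ∀ ε > 0, ∀ M : ℝ, ∃ x : E3, ∃ t : ℝ, 0 < t ∧ ‖x - x₀‖ < ε ∧ |t - T₀| < ε ∧ M < ‖u x t‖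

/-- The singular set of `u`. -/
def SingularSet (u : E3 → ℝ → E3) : Set (E3 × ℝ) :=
  {z | 0 < z.2 ∧ UnboundedNear u z.1 z.2}

/-- `u · (∂_t u + (u·∇)u + ∇p)`, where `p` is the pressure corresponding to `u(·,t)`. -/
def eulerOp (u : E3 → ℝ → E3) (x : E3) (t : ℝ) : ℝ :=
  ∑ j : Fin 3, u x t j *
    (deriv (fun s => u x s j) t
      + (∑ i : Fin 3, u x t i * pd3 (fun y => u y t j) i x)
      + pd3 (pressureFn (fun y => u y t)) j x)

/-- `u · (∂_t u − νΔu + (u·∇)u + ∇p)`, where `p` is the pressure corresponding to `u(·,t)`. -/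
def nsOp (ν : ℝ) (u : E3 → ℝ → E3) (x : E3) (t : ℝ) : ℝ :=
  ∑ j : Fin 3, u x t j *
    (deriv (fun s => u x s j) t - ν * lap3 (fun y => u y t j) x
      + (∑ i : Fin 3, u x t i * pd3 (fun y => u y t j) i x)
      + pd3 (pressureFn (fun y => u y t)) j x)

/-- The time-dependent modification `h_{1,t}` of `f₁`. -/
def h1d (f₁ φ₁ : Pt → ℝ) (δ t : ℝ) (p : Pt) : ℝ :=
  Real.sqrt (f₁ p ^ 2 - 2 * t * δ * φ₁ p)

/-- The time-dependent modification `h_{2,t}` of `f₂`. -/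
def h2d (w₁ w₂ f₁ φ₁ b₁ b₂ f₂ φ₂ : Pt → ℝ) (δ t : ℝ) (p : Pt) : ℝ :=
  Real.sqrt (f₂ p ^ 2 - 2 * t * δ * φ₂ p +
    ∫ s in (0:ℝ)..t,
      (b₁ p * Fpi1 w₁ w₂ (h1d f₁ φ₁ δ s) p + b₂ p * Fpi2 w₁ w₂ (h1d f₁ φ₁ δ s) p))

/-- The constant `D` of Lemma 3.4 (i). -/
def Dconst (w₁ : Pt → ℝ) : ℝ := (9 / (4 * π)) * ∫ y : E3, (w₁ (Rinv y)) ^ 2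

/-- A (planar, open) rectangle. -/
def IsRect (V : Set Pt) : Prop :=
  ∃ a₁ b₁ a₂ b₂ : ℝ, a₁ < b₁ ∧ a₂ < b₂ ∧ V = Ioo a₁ b₁ ×ˢ Ioo a₂ b₂

theorem rad_pos_or_eq_zero (x : E3) : 0 < rad x ∨ rad x = 0 :=
  (Real.sqrt_nonneg _).lt_or_eq.imp id Eq.symm

theorem rad_sq (x : E3) : rad x ^ 2 = x 1 ^ 2 + x 2 ^ 2 :=
  Real.sq_sqrt (by positivity)

theorem continuous_Rinv : Continuous Rinv := by
  unfold Rinv rad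
  fun_prop

theorem Rinv_e3 {a b : ℝ} (hb : 0 ≤ b) : Rinv (e3 a b 0) = (a, b) := by
  simp [Rinv, rad, e3, Real.sqrt_sq hb]

theorem hasFDerivAt_coord (i : Fin 3) (x : E3) :
    HasFDerivAt (fun y : E3 => y i) (EuclideanSpace.proj i : E3 →L[ℝ] ℝ) x :=
  (EuclideanSpace.proj i : E3 →L[ℝ] ℝ).hasFDerivAt

theorem hasFDerivAt_rad {x : E3} (hx : 0 < rad x) :
    HasFDerivAt rad ((x 1 / rad x) • (EuclideanSpace.proj 1 : E3 →L[ℝ] ℝ) +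
      (x 2 / rad x) • (EuclideanSpace.proj 2 : E3 →L[ℝ] ℝ)) x := by
  have hne : x 1 ^ 2 + x 2 ^ 2 ≠ 0 := by rw [← rad_sq]; positivity
  have h := (((hasFDerivAt_coord 1 x).pow 2).add ((hasFDerivAt_coord 2 x).pow 2)).sqrt hne
  refine h.congr_fderiv ?_
  ext y
  have hr : √(x 1 ^ 2 + x 2 ^ 2) = rad x := rfl
  simp [hr]
  field_simp

theorem hasFDerivAt_comp_Rinv {g : Pt → ℝ} {x : E3} (hx : 0 < rad x)
    (hg : DifferentiableAt ℝ g (Rinv x)) :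
    HasFDerivAt (fun y => g (Rinv y))
      (pdx g (Rinv x) • (EuclideanSpace.proj 0 : E3 →L[ℝ] ℝ) +
        pdy g (Rinv x) • ((x 1 / rad x) • (EuclideanSpace.proj 1 : E3 →L[ℝ] ℝ) +
          (x 2 / rad x) • (EuclideanSpace.proj 2 : E3 →L[ℝ] ℝ))) x := by
  have h := hg.hasFDerivAt.comp x ((hasFDerivAt_coord 0 x).prodMk (hasFDerivAt_rad hx))
  refine h.congr_fderiv ?_
  ext y
  have key (a b : ℝ) : fderiv ℝ g (Rinv x) (a, b) =
      pdx g (Rinv x) * a + pdy g (Rinv x) * b := by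
    have : ((a, b) : Pt) = a • ((1, 0) : Pt) + b • ((0, 1) : Pt) := by simp
    rw [this, map_add, map_smul, map_smul, pdx, pdy]
    simp [mul_comm]
  simp [key, mul_add]

theorem hasFDerivAt_comp_Rinv_mul_coord_div_rad {g : Pt → ℝ} {x : E3} (hx : 0 < rad x)
    (hg : DifferentiableAt ℝ g (Rinv x)) (j : Fin 3) :
    HasFDerivAt (fun y => g (Rinv y) * (y j / rad y))
      ((x j / rad x) • (pdx g (Rinv x) • (EuclideanSpace.proj 0 : E3 →L[ℝ] ℝ)) +
        (x j / rad x * pdy g (Rinv x) - g (Rinv x) * x j / rad x ^ 2) •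
          ((x 1 / rad x) • (EuclideanSpace.proj 1 : E3 →L[ℝ] ℝ) +
            (x 2 / rad x) • (EuclideanSpace.proj 2 : E3 →L[ℝ] ℝ)) +
        (g (Rinv x) / rad x) • (EuclideanSpace.proj j : E3 →L[ℝ] ℝ)) x := by
  have h := (hasFDerivAt_comp_Rinv hx hg).mul
    ((hasFDerivAt_coord j x).mul
      ((hasDerivAt_inv hx.ne').comp_hasFDerivAt x (hasFDerivAt_rad hx)))
  refine h.congr_fderiv ?_
  ext y
  simp
  field_simp
  ring

theorem rad_mul_div3_uvf {v₁ v₂ f : Pt → ℝ} {x : E3} (hx : 0 < rad x)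
    (h₁ : DifferentiableAt ℝ v₁ (Rinv x)) (h₂ : DifferentiableAt ℝ v₂ (Rinv x))
    (hw : DifferentiableAt ℝ (wcomp v₁ v₂ f) (Rinv x)) :
    rad x * div3 (uvf v₁ v₂ f) x = div2w v₁ v₂ (Rinv x) := by
  have e₀ : pd3 (fun y => uvf v₁ v₂ f y 0) 0 x = _ :=
    congrArg (· (EuclideanSpace.single 0 1)) (hasFDerivAt_comp_Rinv hx h₁).fderiv
  have e₁ : pd3 (fun y => uvf v₁ v₂ f y 1) 1 x = _ :=
    congrArg (· (EuclideanSpace.single 1 1))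
      ((hasFDerivAt_comp_Rinv_mul_coord_div_rad hx h₂ 1).sub
        (hasFDerivAt_comp_Rinv_mul_coord_div_rad hx hw 2)).fderiv
  have e₂ : pd3 (fun y => uvf v₁ v₂ f y 2) 2 x = _ :=
    congrArg (· (EuclideanSpace.single 2 1))
      ((hasFDerivAt_comp_Rinv_mul_coord_div_rad hx h₂ 2).add
        (hasFDerivAt_comp_Rinv_mul_coord_div_rad hx hw 1)).fderiv
  have hsnd : HasFDerivAt (fun q : Pt => q.2) (ContinuousLinearMap.snd ℝ ℝ ℝ) (Rinv x) :=
    hasFDerivAt_snd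
  have d₁ : pdx (fun q => q.2 * v₁ q) (Rinv x) = rad x * pdx v₁ (Rinv x) := by
    rw [pdx, (hsnd.fun_mul h₁.hasFDerivAt).fderiv]
    simp [pdx, Rinv]
  have d₂ : pdy (fun q => q.2 * v₂ q) (Rinv x) = rad x * pdy v₂ (Rinv x) + v₂ (Rinv x) := by
    rw [pdy, (hsnd.fun_mul h₂.hasFDerivAt).fderiv]
    simp [pdy, Rinv]
  rw [div3, Fin.sum_univ_three, e₀, e₁, e₂, div2w, d₁, d₂]
  simp
  have hr := rad_sq x
  field_simp
  have hr' : x 2 ^ 2 = rad x ^ 2 - x 1 ^ 2 := by linarith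
  ring_nf
  simp only [hr']
  ring

theorem differentiable_wcomp {v₁ v₂ f : Pt → ℝ} (hv₁ : Differentiable ℝ v₁)
    (hv₂ : Differentiable ℝ v₂) (hf : Differentiable ℝ f) (hf0 : ∀ p, 0 ≤ f p)
    (hfv : ∀ p ∈ tsupport v₁ ∪ tsupport v₂, √(v₁ p ^ 2 + v₂ p ^ 2) < f p) :
    Differentiable ℝ (wcomp v₁ v₂ f) := by
  intro p
  by_cases hp : p ∈ tsupport v₁ ∪ tsupport v₂
  · have hlt : v₁ p ^ 2 + v₂ p ^ 2 < f p ^ 2 := Real.lt_sq_of_sqrt_lt (hfv p hp)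
    exact DifferentiableAt.sqrt (by fun_prop) (by linarith)
  · rw [mem_union, not_or] at hp
    refine (hf p).congr_of_eventuallyEq ?_
    filter_upwards [notMem_tsupport_iff_eventuallyEq.mp hp.1,
      notMem_tsupport_iff_eventuallyEq.mp hp.2] with q hq₁ hq₂
    simp [wcomp, hq₁, hq₂, Real.sqrt_sq (hf0 q)]

theorem div3_uvf_eq_zero_of_rad_eq_zero {v₁ v₂ f : Pt → ℝ} (hv₁ : tsupport v₁ ⊆ Pset)
    (hv₂ : tsupport v₂ ⊆ Pset) (hf : tsupport f ⊆ Pset) {x : E3} (hx : rad x = 0) :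
    div3 (uvf v₁ v₂ f) x = 0 := by
  have hxP : Rinv x ∉ Pset := by simp [Pset, Rinv, hx]
  have ev {g : Pt → ℝ} (hg : tsupport g ⊆ Pset) : ∀ᶠ y in 𝓝 x, g (Rinv y) = 0 :=
    continuous_Rinv.continuousAt.eventually
      (notMem_tsupport_iff_eventuallyEq.mp fun h => hxP (hg h))
  have hu : uvf v₁ v₂ f =ᶠ[𝓝 x] fun _ => 0 := by
    filter_upwards [ev hv₁, ev hv₂, ev hf] with y h₁ h₂ h₃
    ext i
    fin_cases i <;> simp [uvf, e3, wcomp, h₁, h₂, h₃]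
  refine Finset.sum_eq_zero fun i _ => ?_
  have hi : (fun y => uvf v₁ v₂ f y i) =ᶠ[𝓝 x] fun _ => 0 := by
    filter_upwards [hu] with y hy
    simp [hy]
  rw [pd3, hi.fderiv_eq]
  simp

/-- Lemma 2.1 (i): `u[v,f]` is divergence free iff `div(x₂ v) = 0` on `P`. -/
theorem statement_4 (v₁ v₂ f : Pt → ℝ)
    (hv₁ : SmoothCompSuppP v₁) (hv₂ : SmoothCompSuppP v₂)
    (hf : SmoothCompSuppP f) (hf0 : ∀ p, 0 ≤ f p)
    (hfv : ∀ p ∈ tsupport v₁ ∪ tsupport v₂, Real.sqrt (v₁ p ^ 2 + v₂ p ^ 2) < f p) :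
    (∀ x : E3, div3 (uvf v₁ v₂ f) x = 0) ↔ (∀ p ∈ Pset, div2w v₁ v₂ p = 0) := by
  have d₁ : Differentiable ℝ v₁ := hv₁.1.differentiable (by simp)
  have d₂ : Differentiable ℝ v₂ := hv₂.1.differentiable (by simp)
  have dw := differentiable_wcomp d₁ d₂ (hf.1.differentiable (by simp)) hf0 hfv
  constructor
  · rintro h ⟨a, b⟩ (hp : 0 < b)
    have hR : Rinv (e3 a b 0) = (a, b) := Rinv_e3 hp.le
    have hr : 0 < rad (e3 a b 0) := hp.trans_eq (congrArg Prod.snd hR).symm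
    rw [← hR, ← rad_mul_div3_uvf hr (d₁ _) (d₂ _) (dw _), h, mul_zero]
  · intro h x
    rcases rad_pos_or_eq_zero x with hx | hx
    · have := rad_mul_div3_uvf hx (d₁ _) (d₂ _) (dw _)
      rw [h (Rinv x) hx] at this
      exact (mul_eq_zero.mp this).resolve_left hx.ne'
    · exact div3_uvf_eq_zero_of_rad_eq_zero hv₁.2.2 hv₂.2.2 hf.2.2 hx
end
end

section
/- Let U be an open set compactly contained in P that is either an open rectangle (a₁,b₁)×(a₂,b₂) or a rectangular ring U = V ∖ closure(W) for open rectangles V, W compactly contained in P with closure(W) ⊂ V. Given η > 0 there exist δ ∈ (0,η) and f ∈ C₀^∞(P;[0,1]) such that supp f = closure(U), f > 0 in U, f = 1 on U_η := {x ∈ U : dist(x, ∂U) > η}, and Lf > 0 in U ∖ U_δ, where U_δ := {x ∈ U : dist(x, ∂U) > δ}. -/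
noncomputable section

open MeasureTheory Real Set Filter Topology

section StepFunctions

theorem hasDerivAt_expNegInvGlue {t : ℝ} (ht : 0 < t) :
    HasDerivAt expNegInvGlue (Real.exp (-t⁻¹) * (t ^ 2)⁻¹) t := by
  have h1 : HasDerivAt (fun s : ℝ => Real.exp (-s⁻¹)) (Real.exp (-t⁻¹) * (t ^ 2)⁻¹) t := by
    have := ((hasDerivAt_inv ht.ne').neg).exp
    simpa using this
  refine h1.congr_of_eventuallyEq ?_
  filter_upwards [lt_mem_nhds ht] with s hs
  simp [expNegInvGlue, not_le.2 hs]

theorem deriv_expNegInvGlue {t : ℝ} (ht : 0 < t) :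
    deriv expNegInvGlue t = Real.exp (-t⁻¹) * (t ^ 2)⁻¹ :=
  (hasDerivAt_expNegInvGlue ht).deriv

theorem deriv_deriv_expNegInvGlue {t : ℝ} (ht : 0 < t) :
    deriv (deriv expNegInvGlue) t =
      Real.exp (-t⁻¹) * (t⁻¹ ^ 4 - 2 * t⁻¹ ^ 3) := by
  have h1 : HasDerivAt (fun s : ℝ => Real.exp (-s⁻¹) * (s ^ 2)⁻¹)
      (Real.exp (-t⁻¹) * (t⁻¹ ^ 4 - 2 * t⁻¹ ^ 3)) t := by
    have h2 := ((hasDerivAt_inv ht.ne').neg).exp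
    have h3 := (hasDerivAt_pow 2 t).inv (by positivity)
    refine (h2.mul h3).congr_deriv ?_
    simp only [Pi.neg_apply, Pi.inv_apply]
    field_simp
    push_cast
    ring
  refine (h1.congr_of_eventuallyEq ?_).deriv
  filter_upwards [lt_mem_nhds ht] with s hs
  exact deriv_expNegInvGlue hs

/-- A smooth step whose second derivative dominates its first-order jet at the left end of
its support. -/
theorem exists_smooth_step {r : ℝ} (hr : 0 < r) :
    ∃ σ : ℝ → ℝ, ContDiff ℝ (⊤ : ℕ∞) σ ∧ (∀ t, σ t ∈ Icc (0 : ℝ) 1) ∧ (∀ t ≤ 0, σ t = 0) ∧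
      (∀ t, 0 < t → 0 < σ t) ∧ (∀ t, r ≤ t → σ t = 1) ∧
      ∀ C : ℝ, ∃ δ > 0, ∀ t, 0 < t → t ≤ δ →
        C * (σ t + |deriv σ t|) < deriv (deriv σ) t := by
  set S : ℝ → ℝ := fun t => smoothTransition (3 * t / r - 1) with hS
  set σ : ℝ → ℝ := fun t => (1 - S t) * expNegInvGlue t + S t with hσ
  have hS0 : ∀ t, 0 ≤ S t := fun t => smoothTransition.nonneg _
  have hS1 : ∀ t, S t ≤ 1 := fun t => smoothTransition.le_one _
  have hE0 : ∀ t, 0 ≤ expNegInvGlue t := expNegInvGlue.nonneg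
  have hE1 : ∀ t, expNegInvGlue t ≤ 1 := by
    intro t
    unfold expNegInvGlue
    split_ifs with h
    · norm_num
    · rw [Real.exp_le_one_iff]
      have : 0 < t⁻¹ := inv_pos.2 (not_le.1 h)
      linarith
  have hsmall : ∀ t, t ≤ r / 3 → S t = 0 := by
    intro t ht
    apply smoothTransition.zero_of_nonpos
    have : 3 * t / r ≤ 1 := by rw [div_le_one hr]; linarith
    linarith
  refine ⟨σ, ?_, ?_, ?_, ?_, ?_, ?_⟩
  · have : ContDiff ℝ (⊤ : ℕ∞) S :=
      smoothTransition.contDiff.comp (by fun_prop)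
    exact ((contDiff_const.sub this).mul expNegInvGlue.contDiff).add this
  · intro t
    constructor
    · have := mul_nonneg (sub_nonneg.2 (hS1 t)) (hE0 t)
      have := hS0 t
      simp only [hσ]; linarith
    · have := mul_nonneg (sub_nonneg.2 (hS1 t)) (sub_nonneg.2 (hE1 t))
      simp only [hσ]; linarith
  · intro t ht
    simp only [hσ, hsmall t (by linarith), expNegInvGlue.zero_of_nonpos ht]
    norm_num
  · intro t ht
    have hE := expNegInvGlue.pos_of_pos ht
    rcases (hS0 t).eq_or_lt with h | h
    · simp only [hσ, ← h]; linarith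
    · have := mul_nonneg (sub_nonneg.2 (hS1 t)) (hE0 t)
      simp only [hσ]; linarith
  · intro t ht
    have : S t = 1 := by
      apply smoothTransition.one_of_one_le
      have : 3 ≤ 3 * t / r := by rw [le_div_iff₀ hr]; linarith
      linarith
    simp [hσ, this]
  · intro C
    have key : ∀ t, 0 < t → t < r / 3 → σ =ᶠ[𝓝 t] expNegInvGlue := by
      intro t _ ht
      filter_upwards [gt_mem_nhds ht] with s hs
      simp [hσ, hsmall s hs.le]
    set D := |C| with hD
    have hD0 : 0 ≤ D := abs_nonneg _
    refine ⟨min (r / 4) (1 / (4 + 2 * D)), by positivity, ?_⟩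
    intro t ht htδ
    have htr : t < r / 3 := by
      have := htδ.trans (min_le_left _ _)
      linarith
    have h := key t ht htr
    rw [h.eq_of_nhds, h.deriv_eq, h.deriv.deriv_eq, deriv_expNegInvGlue ht,
      deriv_deriv_expNegInvGlue ht]
    have hE : expNegInvGlue t = Real.exp (-t⁻¹) := by
      simp [expNegInvGlue, not_le.2 ht]
    rw [hE, abs_of_nonneg (by positivity), ← inv_pow]
    have hu : 4 + 2 * D ≤ t⁻¹ := by
      rw [le_inv_comm₀ (by positivity) ht]
      simpa using htδ.trans (min_le_right _ _)
    set u := t⁻¹ with hu'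
    have he := Real.exp_pos (-u)
    have h1 : C * (1 + u ^ 2) ≤ D * (1 + u ^ 2) :=
      mul_le_mul_of_nonneg_right (le_abs_self C) (by positivity)
    have h2 : D * (1 + u ^ 2) < u ^ 4 - 2 * u ^ 3 := by
      have h3 : 2 * D + 2 ≤ u * (u - 2) := by nlinarith
      have h4 : (2 * D + 2) * u ^ 2 ≤ u * (u - 2) * u ^ 2 :=
        mul_le_mul_of_nonneg_right h3 (by positivity)
      have h5 : 1 < u ^ 2 := by nlinarith
      nlinarith
    have := mul_lt_mul_of_pos_left (h1.trans_lt h2) he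
    linarith

end StepFunctions

section Cutoffs

theorem deriv_reflect (g : ℝ → ℝ) (a : ℝ) :
    deriv (fun s => g (a - s)) = fun s => -deriv g (a - s) :=
  funext fun s => deriv_comp_const_sub g a s

theorem deriv_deriv_reflect (g : ℝ → ℝ) (a : ℝ) :
    deriv (deriv fun s => g (a - s)) = fun s => deriv (deriv g) (a - s) := by
  rw [deriv_reflect]
  funext s
  rw [deriv.fun_neg, deriv_comp_const_sub, neg_neg]

theorem deriv_translate (g : ℝ → ℝ) (a : ℝ) :
    deriv (fun s => g (s - a)) = fun s => deriv g (s - a) :=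
  funext fun s => deriv_comp_sub_const g a s

theorem deriv_deriv_translate (g : ℝ → ℝ) (a : ℝ) :
    deriv (deriv fun s => g (s - a)) = fun s => deriv (deriv g) (s - a) := by
  rw [deriv_translate, deriv_translate]

/-- A cut-off function supported on `[a, b]`. -/
theorem exists_interval_cutoff {a b η : ℝ} (hab : a < b) (hη : 0 < η) :
    ∃ χ : ℝ → ℝ, ContDiff ℝ (⊤ : ℕ∞) χ ∧ (∀ t, χ t ∈ Icc (0 : ℝ) 1) ∧
      (∀ t, t ∉ Ioo a b → χ t = 0) ∧ (∀ t ∈ Ioo a b, 0 < χ t) ∧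
      (∀ t, a + η ≤ t → t ≤ b - η → χ t = 1) ∧
      ∀ C : ℝ, ∃ δ > 0, ∀ t ∈ Ioo a b, t ≤ a + δ ∨ b - δ ≤ t →
        C * (χ t + |deriv χ t|) < deriv (deriv χ) t := by
  set r := min η ((b - a) / 2) with hr
  have hr0 : 0 < r := lt_min hη (by linarith)
  have hrη : r ≤ η := min_le_left _ _
  have hrab : r ≤ (b - a) / 2 := min_le_right _ _
  obtain ⟨σ, hσ, h01, hz, hp, h1, hC⟩ := exists_smooth_step hr0
  set χ : ℝ → ℝ := fun t => σ (t - a) * σ (b - t) with hχ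
  refine ⟨χ, ?_, ?_, ?_, ?_, ?_, ?_⟩
  · exact (hσ.comp (contDiff_id.sub contDiff_const)).mul
      (hσ.comp (contDiff_const.sub contDiff_id))
  · exact fun t => ⟨mul_nonneg (h01 _).1 (h01 _).1, mul_le_one₀ (h01 _).2 (h01 _).1 (h01 _).2⟩
  · intro t ht
    rcases le_or_gt t a with h | h
    · simp [hχ, hz (t - a) (by linarith)]
    · have : b ≤ t := not_lt.1 fun h' => ht ⟨h, h'⟩
      simp [hχ, hz (b - t) (by linarith)]
  · exact fun t ht => mul_pos (hp _ (sub_pos.2 ht.1)) (hp _ (sub_pos.2 ht.2))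
  · intro t h h'
    simp [hχ, h1 (t - a) (by linarith), h1 (b - t) (by linarith)]
  · intro C
    obtain ⟨δ, hδ, hCδ⟩ := hC C
    refine ⟨min δ ((b - a) / 4), lt_min hδ (by linarith), ?_⟩
    have hm1 : min δ ((b - a) / 4) ≤ δ := min_le_left _ _
    have hm2 : min δ ((b - a) / 4) ≤ (b - a) / 4 := min_le_right _ _
    rintro t ⟨hta, htb⟩ (h | h)
    · have hev : χ =ᶠ[𝓝 t] fun t => σ (t - a) := by
        filter_upwards [gt_mem_nhds (show t < b - r by linarith)] with s hs
        simp [hχ, h1 (b - s) (by linarith)]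
      rw [hev.eq_of_nhds, hev.deriv_eq, hev.deriv.deriv_eq, deriv_deriv_translate,
        deriv_translate]
      exact hCδ _ (by linarith) (by linarith)
    · have hev : χ =ᶠ[𝓝 t] fun t => σ (b - t) := by
        filter_upwards [lt_mem_nhds (show a + r < t by linarith)] with s hs
        simp [hχ, h1 (s - a) (by linarith)]
      rw [hev.eq_of_nhds, hev.deriv_eq, hev.deriv.deriv_eq, deriv_deriv_reflect,
        deriv_reflect, abs_neg]
      exact hCδ _ (by linarith) (by linarith)

/-- A smooth function vanishing exactly on `[c, d]` and equal to `1` away from it. -/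
theorem exists_interval_excision {c d η : ℝ} (hcd : c < d) (hη : 0 < η) :
    ∃ φ : ℝ → ℝ, ContDiff ℝ (⊤ : ℕ∞) φ ∧ (∀ t, φ t ∈ Icc (0 : ℝ) 1) ∧
      (∀ t ∈ Icc c d, φ t = 0) ∧ (∀ t, t ∉ Icc c d → 0 < φ t) ∧
      (∀ t, t ≤ c - η ∨ d + η ≤ t → φ t = 1) ∧
      ∀ C : ℝ, ∃ δ > 0, ∀ t ∈ Icc (c - δ) (d + δ), φ t ≤ 1 / 2 ∧
        C * (φ t + |deriv φ t|) ≤ deriv (deriv φ) t ∧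
        (t ∉ Icc c d → C * (φ t + |deriv φ t|) < deriv (deriv φ) t) := by
  obtain ⟨σ, hσ, h01, hz, hp, h1, hC⟩ := exists_smooth_step hη
  set φ : ℝ → ℝ := fun t => σ (c - t) + σ (t - d) with hφ
  have hleft : ∀ t < d, φ =ᶠ[𝓝 t] fun t => σ (c - t) := by
    intro t ht
    filter_upwards [gt_mem_nhds ht] with s hs
    simp [hφ, hz (s - d) (by linarith)]
  have hright : ∀ t > c, φ =ᶠ[𝓝 t] fun t => σ (t - d) := by
    intro t ht
    filter_upwards [lt_mem_nhds ht] with s hs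
    simp [hφ, hz (c - s) (by linarith)]
  have hsm : ContDiff ℝ (⊤ : ℕ∞) φ :=
    (hσ.comp (contDiff_const.sub contDiff_id)).add (hσ.comp (contDiff_id.sub contDiff_const))
  refine ⟨φ, hsm, ?_, ?_, ?_, ?_, ?_⟩
  · intro t
    rcases lt_or_ge t d with h | h
    · rw [(hleft t h).eq_of_nhds]; exact h01 _
    · rw [(hright t (by linarith)).eq_of_nhds]; exact h01 _
  · intro t ht
    simp [hφ, hz (t - d) (by linarith [ht.2]), hz (c - t) (by linarith [ht.1])]
  · intro t ht
    rcases lt_or_ge t c with h | h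
    · rw [(hleft t (by linarith)).eq_of_nhds]; exact hp _ (by linarith)
    · have : d < t := not_le.1 fun h' => ht ⟨h, h'⟩
      rw [(hright t (by linarith)).eq_of_nhds]; exact hp _ (by linarith)
  · rintro t (h | h)
    · rw [(hleft t (by linarith)).eq_of_nhds]; exact h1 _ (by linarith)
    · rw [(hright t (by linarith)).eq_of_nhds]; exact h1 _ (by linarith)
  · intro C
    obtain ⟨δ, hδ, hCδ⟩ := hC C
    obtain ⟨ε, hε, hsmall⟩ : ∃ ε > 0, ∀ t, t ≤ ε → σ t ≤ 1 / 2 := by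
      have : ∀ᶠ t in 𝓝 (0 : ℝ), σ t < 1 / 2 :=
        hσ.continuous.continuousAt.eventually (gt_mem_nhds (by rw [hz 0 le_rfl]; norm_num))
      obtain ⟨ε, hε, h⟩ := Metric.eventually_nhds_iff.1 this
      refine ⟨ε / 2, by positivity, fun t ht => ?_⟩
      rcases le_or_gt t 0 with h0 | h0
      · rw [hz t h0]; norm_num
      · exact (h (by rw [Real.dist_0_eq_abs, abs_of_pos h0]; linarith)).le
    have hin : ∀ t ∈ Icc c d, C * (φ t
          + |deriv φ t|)
          ≤ deriv (deriv φ) t := by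
      have hd1 : ContDiff ℝ (⊤ : ℕ∞) (deriv φ) := (contDiff_infty_iff_deriv.1 hsm).2
      have hd2 : ContDiff ℝ (⊤ : ℕ∞) (deriv (deriv φ)) := (contDiff_infty_iff_deriv.1 hd1).2
      have hclosed : IsClosed {t | C * (φ t + |deriv φ t|) ≤ deriv (deriv φ) t} :=
        isClosed_le (continuous_const.mul (hsm.continuous.add hd1.continuous.abs))
          hd2.continuous
      rw [← closure_Ioo hcd.ne]
      refine closure_minimal ?_ hclosed
      intro t ht
      have hev : φ =ᶠ[𝓝 t] fun _ => 0 := by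
        filter_upwards [Ioo_mem_nhds ht.1 ht.2] with s hs
        simp [hφ, hz (s - d) (by linarith [hs.2]), hz (c - s) (by linarith [hs.1])]
      change C * (φ t + |deriv φ t|) ≤ deriv (deriv φ) t
      rw [hev.eq_of_nhds, hev.deriv_eq, hev.deriv.deriv_eq]
      simp
    have hout : ∀ t ∈ Icc (c - min δ ε) (d + min δ ε), t ∉ Icc c d →
        C * (φ t
          + |deriv φ t|)
          < deriv (deriv φ) t := by
      rintro t ⟨ht1, ht2⟩ ht
      have hm : min δ ε ≤ δ := min_le_left _ _
      rcases lt_or_ge t c with h | h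
      · have hev := hleft t (by linarith)
        rw [hev.eq_of_nhds, hev.deriv_eq, hev.deriv.deriv_eq, deriv_deriv_reflect,
          deriv_reflect, abs_neg]
        exact hCδ _ (by linarith) (by linarith)
      · have : d < t := not_le.1 fun h' => ht ⟨h, h'⟩
        have hev := hright t (by linarith)
        rw [hev.eq_of_nhds, hev.deriv_eq, hev.deriv.deriv_eq, deriv_deriv_translate,
          deriv_translate]
        exact hCδ _ (by linarith) (by linarith)
    refine ⟨min δ ε, lt_min hδ hε, fun t ht => ⟨?_, ?_, hout t ht⟩⟩
    · have hm : min δ ε ≤ ε := min_le_right _ _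
      rcases lt_or_ge t d with h | h
      · rw [(hleft t h).eq_of_nhds]; exact hsmall _ (by linarith [ht.1])
      · rw [(hright t (by linarith)).eq_of_nhds]; exact hsmall _ (by linarith [ht.2])
    · by_cases h : t ∈ Icc c d
      · exact hin t h
      · exact (hout t ht h).le

end Cutoffs

section PlanarOperator

theorem pdx_mul_separated {u v : ℝ → ℝ} (hu : Differentiable ℝ u) (hv : Differentiable ℝ v) :
    (fun q => pdx (fun q => u q.1 * v q.2) q) = fun q => deriv u q.1 * v q.2 := by
  funext q
  have h1 : HasFDerivAt (fun q : Pt => u q.1) _ q :=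
    (hu q.1).hasDerivAt.comp_hasFDerivAt q (hasFDerivAt_fst (𝕜 := ℝ) (p := q))
  have h2 : HasFDerivAt (fun q : Pt => v q.2) _ q :=
    (hv q.2).hasDerivAt.comp_hasFDerivAt q (hasFDerivAt_snd (𝕜 := ℝ) (p := q))
  rw [pdx, (h1.fun_mul h2).fderiv]
  simp [mul_comm]

theorem pdy_mul_separated {u v : ℝ → ℝ} (hu : Differentiable ℝ u) (hv : Differentiable ℝ v) :
    (fun q => pdy (fun q => u q.1 * v q.2) q) = fun q => u q.1 * deriv v q.2 := by
  funext q
  have h1 : HasFDerivAt (fun q : Pt => u q.1) _ q :=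
    (hu q.1).hasDerivAt.comp_hasFDerivAt q (hasFDerivAt_fst (𝕜 := ℝ) (p := q))
  have h2 : HasFDerivAt (fun q : Pt => v q.2) _ q :=
    (hv q.2).hasDerivAt.comp_hasFDerivAt q (hasFDerivAt_snd (𝕜 := ℝ) (p := q))
  rw [pdy, (h1.fun_mul h2).fderiv]
  simp

theorem Lop_mul_separated {u v : ℝ → ℝ} (hu : ContDiff ℝ (⊤ : ℕ∞) u)
    (hv : ContDiff ℝ (⊤ : ℕ∞) v) (p : Pt) :
    Lop (fun q => u q.1 * v q.2) p =
      deriv (deriv u) p.1 * v p.2 +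
        u p.1 * (deriv (deriv v) p.2 + deriv v p.2 / p.2 - v p.2 / p.2 ^ 2) := by
  have hu' := contDiff_infty_iff_deriv.1 hu
  have hv' := contDiff_infty_iff_deriv.1 hv
  have hu'' := contDiff_infty_iff_deriv.1 hu'.2
  have hv'' := contDiff_infty_iff_deriv.1 hv'.2
  have he1 := pdx_mul_separated hu'.1 hv'.1
  have he2 := pdy_mul_separated hu'.1 hv'.1
  have he3 := congrFun (pdx_mul_separated hu''.1 hv'.1) p
  have he4 := congrFun (pdy_mul_separated hu'.1 hv''.1) p
  have he5 := congrFun he2 p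
  rw [Lop, he1, he2, he3, he4, he5]
  ring

theorem Lop_one_sub {g : Pt → ℝ} (p : Pt) :
    Lop (fun q => 1 - g q) p = -Lop g p - 1 / p.2 ^ 2 := by
  have hx : ∀ (h : Pt → ℝ) q, pdx (fun q => 1 - h q) q = -pdx h q := by
    intro h q; simp [pdx, fderiv_const_sub]
  have hy : ∀ (h : Pt → ℝ) q, pdy (fun q => 1 - h q) q = -pdy h q := by
    intro h q; simp [pdy, fderiv_const_sub]
  have hx' : ∀ (h : Pt → ℝ) q, pdx (fun q => -h q) q = -pdx h q := by
    intro h q; simp [pdx, fderiv_fun_neg]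
  have hy' : ∀ (h : Pt → ℝ) q, pdy (fun q => -h q) q = -pdy h q := by
    intro h q; simp [pdy, fderiv_fun_neg]
  simp only [Lop, hx, hy, hx', hy']
  ring

theorem Lop_congr {f g : Pt → ℝ} {p : Pt} (h : f =ᶠ[𝓝 p] g) : Lop f p = Lop g p := by
  have hx : (fun q => pdx f q) =ᶠ[𝓝 p] fun q => pdx g q :=
    (h.fderiv (𝕜 := ℝ)).mono fun q hq => by simp only [pdx, hq]
  have hy : (fun q => pdy f q) =ᶠ[𝓝 p] fun q => pdy g q :=
    (h.fderiv (𝕜 := ℝ)).mono fun q hq => by simp only [pdy, hq]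
  have hxx : pdx (fun q => pdx f q) p = pdx (fun q => pdx g q) p := by
    rw [pdx, pdx, hx.fderiv_eq]
  have hyy : pdy (fun q => pdy f q) p = pdy (fun q => pdy g q) p := by
    rw [pdy, pdy, hy.fderiv_eq]
  have hy0 : pdy f p = pdy g p := hy.eq_of_nhds
  rw [Lop, Lop, hxx, hyy, hy0, h.eq_of_nhds]

theorem abs_radial_terms_le {a y u v : ℝ} (ha : 0 < a) (hy : a ≤ y) (hu : 0 ≤ u) :
    |v / y - u / y ^ 2| ≤ (1 / a + 1 / a ^ 2) * (u + |v|) := by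
  have hy0 : 0 < y := ha.trans_le hy
  have h1 : |v / y| ≤ |v| / a := by
    rw [abs_div, abs_of_pos hy0]; gcongr
  have h2 : |u / y ^ 2| ≤ u / a ^ 2 := by
    rw [abs_of_nonneg (by positivity)]; gcongr
  calc |v / y - u / y ^ 2| ≤ |v / y| + |u / y ^ 2| := abs_sub _ _
    _ ≤ |v| / a + u / a ^ 2 := add_le_add h1 h2
    _ ≤ |v| / a + u / a ^ 2 + (u / a + |v| / a ^ 2) := by
      have : 0 ≤ u / a + |v| / a ^ 2 := by positivity
      linarith
    _ = _ := by ring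

/-- If `K` beats every multiple of `χ` near the ends of `(a, b)`, it is bounded below on
`(a, b)` by a multiple of `χ`. -/
theorem exists_lower_multiple {a b : ℝ} {χ K : ℝ → ℝ} (hχ : Continuous χ)
    (hK : ContinuousOn K (Ioo a b)) (hpos : ∀ t ∈ Ioo a b, 0 < χ t)
    (hend : ∃ δ > 0, ∀ t ∈ Ioo a b, t ≤ a + δ ∨ b - δ ≤ t → 0 < K t) :
    ∃ M : ℝ, ∀ t ∈ Ioo a b, -(M * χ t) ≤ K t := by
  obtain ⟨δ, hδ, hd⟩ := hend
  have hsub : Icc (a + δ) (b - δ) ⊆ Ioo a b := fun t ht =>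
    ⟨by linarith [ht.1], by linarith [ht.2]⟩
  have hc : ContinuousOn (fun t => K t / χ t) (Icc (a + δ) (b - δ)) :=
    (hK.mono hsub).div hχ.continuousOn fun t ht => (hpos t (hsub ht)).ne'
  obtain ⟨m, hm⟩ := isCompact_Icc.bddBelow_image hc
  refine ⟨max 0 (-m), fun t ht => ?_⟩
  have hχt := hpos t ht
  by_cases h : t ≤ a + δ ∨ b - δ ≤ t
  · have h1 := hd t ht h
    have h2 := mul_nonneg (le_max_left 0 (-m)) hχt.le
    linarith
  · push Not at h
    have h1 : m ≤ K t / χ t := hm ⟨t, ⟨h.1.le, h.2.le⟩, rfl⟩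
    rw [le_div_iff₀ hχt] at h1
    have h2 := mul_le_mul_of_nonneg_right (le_max_right 0 (-m)) hχt.le
    linarith

/-- The cut-off function of a rectangle. -/
theorem exists_rect_cutoff {a₁ b₁ a₂ b₂ η : ℝ} (h₁ : a₁ < b₁) (h₂ : a₂ < b₂) (ha : 0 < a₂)
    (hη : 0 < η) :
    ∃ F : Pt → ℝ, ContDiff ℝ (⊤ : ℕ∞) F ∧ (∀ p, F p ∈ Icc (0 : ℝ) 1) ∧
      (∀ p, p ∉ Ioo a₁ b₁ ×ˢ Ioo a₂ b₂ → F p = 0) ∧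
      (∀ p ∈ Ioo a₁ b₁ ×ˢ Ioo a₂ b₂, 0 < F p) ∧
      (∀ p ∈ Icc (a₁ + η) (b₁ - η) ×ˢ Icc (a₂ + η) (b₂ - η), F p = 1) ∧
      ∃ δ > 0, ∀ p ∈ Ioo a₁ b₁ ×ˢ Ioo a₂ b₂,
        (p.1 ≤ a₁ + δ ∨ b₁ - δ ≤ p.1 ∨ p.2 ≤ a₂ + δ ∨ b₂ - δ ≤ p.2) → 0 < Lop F p := by
  obtain ⟨u, hu, hu01, hu0, hup, hu1, huC⟩ := exists_interval_cutoff h₁ hη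
  obtain ⟨v, hv, hv01, hv0, hvp, hv1, hvC⟩ := exists_interval_cutoff h₂ hη
  have hu' := contDiff_infty_iff_deriv.1 hu
  have hv' := contDiff_infty_iff_deriv.1 hv
  have hu'' := contDiff_infty_iff_deriv.1 hu'.2
  have hv'' := contDiff_infty_iff_deriv.1 hv'.2
  refine ⟨fun p => u p.1 * v p.2, ?_, ?_, ?_, ?_, ?_, ?_⟩
  · exact (hu.comp contDiff_fst).mul (hv.comp contDiff_snd)
  · exact fun p => ⟨mul_nonneg (hu01 _).1 (hv01 _).1,
      mul_le_one₀ (hu01 _).2 (hv01 _).1 (hv01 _).2⟩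
  · intro p hp
    by_cases h : p.1 ∈ Ioo a₁ b₁
    · simp [hv0 p.2 fun h' => hp ⟨h, h'⟩]
    · simp [hu0 p.1 h]
  · exact fun p hp => mul_pos (hup _ hp.1) (hvp _ hp.2)
  · intro p hp
    simp [hu1 p.1 hp.1.1 hp.1.2, hv1 p.2 hp.2.1 hp.2.2]
  · set K : ℝ → ℝ := fun y => deriv (deriv v) y + deriv v y / y - v y / y ^ 2 with hK
    have hu_end : ∀ N : ℝ, ∃ δ > 0, ∀ t ∈ Ioo a₁ b₁, t ≤ a₁ + δ ∨ b₁ - δ ≤ t →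
        N * u t < deriv (deriv u) t := by
      intro N
      obtain ⟨δ, hδ, h⟩ := huC |N|
      refine ⟨δ, hδ, fun t ht htδ => lt_of_le_of_lt ?_ (h t ht htδ)⟩
      calc N * u t ≤ |N| * u t := mul_le_mul_of_nonneg_right (le_abs_self N) (hu01 t).1
        _ ≤ |N| * (u t + |deriv u t|) := by
          gcongr
          exact le_add_of_nonneg_right (abs_nonneg _)
    have hv_end : ∀ N : ℝ, ∃ δ > 0, ∀ t ∈ Ioo a₂ b₂, t ≤ a₂ + δ ∨ b₂ - δ ≤ t →
        N * v t < K t := by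
      intro N
      obtain ⟨δ, hδ, h⟩ := hvC (|N| + (1 / a₂ + 1 / a₂ ^ 2))
      refine ⟨δ, hδ, fun t ht htδ => ?_⟩
      have h3 := h t ht htδ
      have h4 := (abs_le.1 (abs_radial_terms_le (v := deriv v t) ha ht.1.le (hv01 t).1)).1
      have h5 : N * v t ≤ |N| * (v t + |deriv v t|) := by
        calc N * v t ≤ |N| * v t := mul_le_mul_of_nonneg_right (le_abs_self N) (hv01 t).1
          _ ≤ _ := by
            gcongr
            exact le_add_of_nonneg_right (abs_nonneg _)
      simp only [hK]
      linarith
    obtain ⟨M₁, hM₁⟩ := exists_lower_multiple hu.continuous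
      hu''.2.continuous.continuousOn hup (by simpa using hu_end 0)
    have hKc : ContinuousOn K (Ioo a₂ b₂) := by
      have hne : ∀ y ∈ Ioo a₂ b₂, y ≠ 0 := fun y hy => (ha.trans hy.1).ne'
      exact (hv''.2.continuous.continuousOn.add
        (hv'.2.continuous.continuousOn.div continuousOn_id hne)).sub
        (hv.continuous.continuousOn.div (continuousOn_id.pow 2)
          fun y hy => pow_ne_zero 2 (hne y hy))
    obtain ⟨M₂, hM₂⟩ := exists_lower_multiple hv.continuous hKc hvp (by simpa using hv_end 0)
    obtain ⟨δ₁, hδ₁, hu_near⟩ := hu_end M₂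
    obtain ⟨δ₂, hδ₂, hv_near⟩ := hv_end M₁
    refine ⟨min δ₁ δ₂, lt_min hδ₁ hδ₂, ?_⟩
    rintro p ⟨hp1, hp2⟩ hnear
    have m1 : min δ₁ δ₂ ≤ δ₁ := min_le_left _ _
    have m2 : min δ₁ δ₂ ≤ δ₂ := min_le_right _ _
    rw [Lop_mul_separated hu hv]
    change 0 < deriv (deriv u) p.1 * v p.2 + u p.1 * K p.2
    have pu := hup _ hp1
    have pv := hvp _ hp2
    have lu := mul_le_mul_of_nonneg_right (hM₁ _ hp1) pv.le
    have lv := mul_le_mul_of_nonneg_left (hM₂ _ hp2) pu.le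
    have hcase : (p.1 ≤ a₁ + δ₁ ∨ b₁ - δ₁ ≤ p.1) ∨ (p.2 ≤ a₂ + δ₂ ∨ b₂ - δ₂ ≤ p.2) := by
      rcases hnear with h | h | h | h
      · exact Or.inl (Or.inl (by linarith))
      · exact Or.inl (Or.inr (by linarith))
      · exact Or.inr (Or.inl (by linarith))
      · exact Or.inr (Or.inr (by linarith))
    rcases hcase with h | h
    · have := mul_lt_mul_of_pos_right (hu_near _ hp1 h) pv
      linarith
    · have := mul_lt_mul_of_pos_left (hv_near _ hp2 h) pu
      linarith

/-- The function cutting a closed rectangle out of the plane. -/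
theorem exists_rect_excision {c₁ d₁ c₂ d₂ η : ℝ} (h₁ : c₁ < d₁) (h₂ : c₂ < d₂) (hc : 0 < c₂)
    (hη : 0 < η) :
    ∃ G : Pt → ℝ, ContDiff ℝ (⊤ : ℕ∞) G ∧ (∀ p, G p ∈ Icc (0 : ℝ) 1) ∧
      (∀ p ∈ Icc c₁ d₁ ×ˢ Icc c₂ d₂, G p = 0) ∧
      (∀ p, p ∉ Icc c₁ d₁ ×ˢ Icc c₂ d₂ → 0 < G p) ∧
      (∀ p : Pt, p.1 ≤ c₁ - η ∨ d₁ + η ≤ p.1 ∨ p.2 ≤ c₂ - η ∨ d₂ + η ≤ p.2 → G p = 1) ∧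
      ∃ δ > 0, ∀ p ∈ Icc (c₁ - δ) (d₁ + δ) ×ˢ Icc (c₂ - δ) (d₂ + δ),
        p ∉ Icc c₁ d₁ ×ˢ Icc c₂ d₂ → 0 < Lop G p := by
  obtain ⟨u, hu, hu01, hu0, hup, hu1, huC⟩ := exists_interval_excision h₁ hη
  obtain ⟨v, hv, hv01, hv0, hvp, hv1, hvC⟩ := exists_interval_excision h₂ hη
  refine ⟨fun p => 1 - (1 - u p.1) * (1 - v p.2), ?_, ?_, ?_, ?_, ?_, ?_⟩
  · exact contDiff_const.sub ((contDiff_const.sub (hu.comp contDiff_fst)).mul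
      (contDiff_const.sub (hv.comp contDiff_snd)))
  · intro p
    obtain ⟨hu2, hu3⟩ := hu01 p.1
    obtain ⟨hv2, hv3⟩ := hv01 p.2
    constructor <;> nlinarith [mul_nonneg (sub_nonneg.2 hu3) (sub_nonneg.2 hv3)]
  · intro p hp
    simp [hu0 _ hp.1, hv0 _ hp.2]
  · intro p hp
    obtain ⟨hu2, hu3⟩ := hu01 p.1
    obtain ⟨hv2, hv3⟩ := hv01 p.2
    by_cases h : p.1 ∈ Icc c₁ d₁
    · have := hvp p.2 fun h' => hp ⟨h, h'⟩
      nlinarith [mul_nonneg hu2 (sub_nonneg.2 hv3)]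
    · have := hup p.1 h
      nlinarith [mul_nonneg hv2 (sub_nonneg.2 hu3)]
  · rintro p (h | h | h | h)
    · simp [hu1 p.1 (Or.inl h)]
    · simp [hu1 p.1 (Or.inr h)]
    · simp [hv1 p.2 (Or.inl h)]
    · simp [hv1 p.2 (Or.inr h)]
  · set a := c₂ / 2 with ha
    have ha0 : 0 < a := by positivity
    set A := 1 / a + 1 / a ^ 2 with hA
    have hA0 : 0 < A := by positivity
    obtain ⟨δ₁, hδ₁, hu_near⟩ := huC (2 * A)
    obtain ⟨δ₂, hδ₂, hv_near⟩ := hvC (2 * A)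
    set δ := min (min δ₁ δ₂) a with hδ
    have m1 : δ ≤ δ₁ := (min_le_left _ _).trans (min_le_left _ _)
    have m2 : δ ≤ δ₂ := (min_le_left _ _).trans (min_le_right _ _)
    have m3 : δ ≤ a := min_le_right _ _
    refine ⟨δ, lt_min (lt_min hδ₁ hδ₂) ha0, ?_⟩
    rintro p ⟨hp1, hp2⟩ hp
    have hy : a ≤ p.2 := by linarith [hp2.1]
    have hy0 : 0 < p.2 := ha0.trans_le hy
    obtain ⟨hu_half, hu_le, hu_lt⟩ :=
      hu_near p.1 ⟨by linarith [hp1.1], by linarith [hp1.2]⟩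
    obtain ⟨hv_half, hv_le, hv_lt⟩ :=
      hv_near p.2 ⟨by linarith [hp2.1], by linarith [hp2.2]⟩
    have pu := (hu01 p.1).1
    have pv := (hv01 p.2).1
    rw [Lop_one_sub, Lop_mul_separated (u := fun t => 1 - u t) (v := fun t => 1 - v t)
      (contDiff_const.sub hu) (contDiff_const.sub hv)]
    have du : deriv (fun t => 1 - u t) = fun t => -deriv u t := by
      funext t; simp
    have ddu : deriv (deriv fun t => 1 - u t) = fun t => -deriv (deriv u) t := by
      rw [du]; funext t; simp
    have dv : deriv (fun t => 1 - v t) = fun t => -deriv v t := by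
      funext t; simp
    have ddv : deriv (deriv fun t => 1 - v t) = fun t => -deriv (deriv v) t := by
      rw [dv]; funext t; simp
    rw [ddu, ddv, dv]
    have hAu : u p.1 / p.2 ^ 2 ≤ A * u p.1 := by
      have := (abs_le.1 (abs_radial_terms_le (v := 0) ha0 hy pu)).1
      simp only [zero_div, abs_zero, add_zero] at this
      linarith
    have hAv := (abs_le.1 (abs_radial_terms_le (v := deriv v p.2) ha0 hy pv)).1
    set u0 := u p.1
    set v0 := v p.2
    set v' := deriv v p.2
    set u'' := deriv (deriv u) p.1
    set v'' := deriv (deriv v) p.2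
    have key : -(-u'' * (1 - v0) + (1 - u0) * (-v'' + -v' / p.2 - (1 - v0) / p.2 ^ 2))
        - 1 / p.2 ^ 2 =
        u'' * (1 - v0) - u0 / p.2 ^ 2 + (1 - u0) * (v'' + (v' / p.2 - v0 / p.2 ^ 2)) := by
      ring
    rw [key]
    have he1 : A * u0 ≤ A * (u0 + |deriv u p.1|) := by
      gcongr
      exact le_add_of_nonneg_right (abs_nonneg _)
    have he2 : 0 ≤ A * (u0 + |deriv u p.1|) := by positivity
    have he3 : 0 ≤ A * (v0 + |v'|) := by positivity
    have s1 : 0 ≤ u'' * (1 - v0) - u0 / p.2 ^ 2 := by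
      have : u'' * (1 / 2) ≤ u'' * (1 - v0) :=
        mul_le_mul_of_nonneg_left (by linarith) (by linarith)
      linarith
    have s2 : 0 ≤ v'' + (v' / p.2 - v0 / p.2 ^ 2) := by linarith
    by_cases h : p.1 ∈ Icc c₁ d₁
    · have hlt := hv_lt fun h' => hp ⟨h, h'⟩
      have : 0 < (1 - u0) * (v'' + (v' / p.2 - v0 / p.2 ^ 2)) :=
        mul_pos (by linarith) (by linarith)
      linarith
    · have hlt := hu_lt h
      have : u'' * (1 / 2) ≤ u'' * (1 - v0) :=
        mul_le_mul_of_nonneg_left (by linarith) (by linarith)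
      have := mul_nonneg (show 0 ≤ 1 - u0 by linarith) s2
      linarith

end PlanarOperator

section DistanceToFrontier

theorem infDist_frontier_le_dist {U : Set Pt} {p z : Pt} (hp : p ∈ U) (hz : z ∉ U) :
    Metric.infDist p (frontier U) ≤ dist p z := by
  obtain ⟨y, hy, hd⟩ := exists_mem_frontier_infDist_compl_eq_dist hp
    (fun h : U = univ => hz (h ▸ mem_univ z))
  calc Metric.infDist p (frontier U) ≤ dist p y := Metric.infDist_le_dist_of_mem hy
    _ = Metric.infDist p Uᶜ := hd.symm
    _ ≤ dist p z := Metric.infDist_le_dist_of_mem hz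

theorem exists_notMem_dist_le_of_infDist_frontier_le {U : Set Pt} {p : Pt} {δ : ℝ}
    (hU : IsOpen U) (hne : U ≠ univ) (hp : p ∈ U)
    (h : Metric.infDist p (frontier U) ≤ δ) : ∃ z ∉ U, dist p z ≤ δ := by
  obtain ⟨y, hy, -⟩ := exists_mem_frontier_infDist_compl_eq_dist hp hne
  obtain ⟨z, hz, hd⟩ := isClosed_frontier.exists_infDist_eq_dist ⟨y, hy⟩ p
  refine ⟨z, fun hzU => ?_, hd ▸ h⟩
  rw [hU.frontier_eq] at hz
  exact hz.2 hzU

/-- The conditions on a cut-off function in terms of the distance to the points outside `U`. -/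
theorem exists_cutoff_of_dist {U : Set Pt} {f : Pt → ℝ} {η : ℝ} (hη : 0 < η) (hU : IsOpen U)
    (hne : U ≠ univ) (hcpt : IsCompact (closure U)) (hf : ContDiff ℝ (⊤ : ℕ∞) f)
    (h01 : ∀ p, f p ∈ Icc (0 : ℝ) 1) (h0 : ∀ p, p ∉ U → f p = 0) (hpos : ∀ p ∈ U, 0 < f p)
    (h1 : ∀ p ∈ U, (∀ z, z ∉ U → η < dist p z) → f p = 1)
    (hL : ∃ δ > 0, ∀ p ∈ U, ∀ z, z ∉ U → dist p z ≤ δ → 0 < Lop f p) :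
    ∃ (δ : ℝ) (f : Pt → ℝ), 0 < δ ∧ δ < η ∧
      ContDiff ℝ (⊤ : ℕ∞) f ∧ HasCompactSupport f ∧ (∀ p, f p ∈ Icc (0:ℝ) 1) ∧
      tsupport f = closure U ∧
      (∀ p ∈ U, 0 < f p) ∧
      (∀ p ∈ U, η < Metric.infDist p (frontier U) → f p = 1) ∧
      (∀ p ∈ U, Metric.infDist p (frontier U) ≤ δ → 0 < Lop f p) := by
  obtain ⟨δ, hδ, hLδ⟩ := hL
  have hsupp : tsupport f = closure U := by
    have : Function.support f = U := by
      ext p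
      exact ⟨fun h => by_contra fun h' => h (h0 p h'), fun h => (hpos p h).ne'⟩
    rw [tsupport, this]
  refine ⟨min δ (η / 2), f, by positivity, ?_, hf, ?_, h01, hsupp, hpos, ?_, ?_⟩
  · exact (min_le_right _ _).trans_lt (by linarith)
  · rwa [HasCompactSupport, hsupp]
  · exact fun p hp h => h1 p hp fun z hz => h.trans_le (infDist_frontier_le_dist hp hz)
  · intro p hp h
    obtain ⟨z, hz, hd⟩ := exists_notMem_dist_le_of_infDist_frontier_le hU hne hp h
    exact hLδ p hp z hz (hd.trans (min_le_left _ _))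

theorem near_side_of_dist_le {a₁ b₁ a₂ b₂ δ : ℝ} {p z : Pt}
    (hz : z ∉ Ioo a₁ b₁ ×ˢ Ioo a₂ b₂) (h : dist p z ≤ δ) :
    p.1 ≤ a₁ + δ ∨ b₁ - δ ≤ p.1 ∨ p.2 ≤ a₂ + δ ∨ b₂ - δ ≤ p.2 := by
  by_contra! hc
  obtain ⟨h1, h2, h3, h4⟩ := hc
  rw [Prod.dist_eq, max_le_iff, Real.dist_eq, Real.dist_eq, abs_le, abs_le] at h
  exact hz ⟨⟨by linarith, by linarith⟩, ⟨by linarith, by linarith⟩⟩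

theorem mem_shrunk_of_lt_dist {a₁ b₁ a₂ b₂ η : ℝ} {p : Pt}
    (hp : p ∈ Ioo a₁ b₁ ×ˢ Ioo a₂ b₂)
    (h : ∀ z, z ∉ Ioo a₁ b₁ ×ˢ Ioo a₂ b₂ → η < dist p z) :
    p ∈ Icc (a₁ + η) (b₁ - η) ×ˢ Icc (a₂ + η) (b₂ - η) := by
  obtain ⟨⟨h1, h2⟩, h3, h4⟩ := hp
  have hx : ∀ t, t ∉ Ioo a₁ b₁ → η < |p.1 - t| := by
    intro t ht
    have := h (t, p.2) fun h' => ht h'.1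
    rwa [Prod.dist_eq, dist_self, max_eq_left dist_nonneg, Real.dist_eq] at this
  have hy : ∀ t, t ∉ Ioo a₂ b₂ → η < |p.2 - t| := by
    intro t ht
    have := h (p.1, t) fun h' => ht h'.2
    rwa [Prod.dist_eq, dist_self, max_eq_right dist_nonneg, Real.dist_eq] at this
  have he1 := hx a₁ fun h => lt_irrefl _ h.1
  have he2 := hx b₁ fun h => lt_irrefl _ h.2
  have he3 := hy a₂ fun h => lt_irrefl _ h.1
  have he4 := hy b₂ fun h => lt_irrefl _ h.2
  rw [abs_of_pos (by linarith)] at he1 he3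
  rw [abs_of_neg (by linarith)] at he2 he4
  exact ⟨⟨by linarith, by linarith⟩, ⟨by linarith, by linarith⟩⟩

theorem exists_mem_Icc_abs_sub_le {c d η t : ℝ} (hcd : c ≤ d) (hη : 0 ≤ η) (h1 : c - η ≤ t)
    (h2 : t ≤ d + η) : ∃ s ∈ Icc c d, |t - s| ≤ η := by
  rcases le_total t c with h | h
  · exact ⟨c, ⟨le_rfl, hcd⟩, abs_le.2 ⟨by linarith, by linarith⟩⟩
  rcases le_total t d with h' | h'
  · exact ⟨t, ⟨h, h'⟩, by simpa using hη⟩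
  · exact ⟨d, ⟨hcd, le_rfl⟩, abs_le.2 ⟨by linarith, by linarith⟩⟩

theorem closure_Ioo_prod_Ioo {a₁ b₁ a₂ b₂ : ℝ} (h₁ : a₁ < b₁) (h₂ : a₂ < b₂) :
    closure (Ioo a₁ b₁ ×ˢ Ioo a₂ b₂) = Icc a₁ b₁ ×ˢ Icc a₂ b₂ := by
  rw [closure_prod_eq, closure_Ioo h₁.ne, closure_Ioo h₂.ne]

end DistanceToFrontier

/-- Theorem 2.4: the cut-off function `f` with `supp f = closure U` and
`Lf > 0` near `∂U`, for `U` a rectangle or a rectangular ring. -/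
theorem statement_9 (U : Set Pt) (hUP : closure U ⊆ Pset)
    (hshape : IsRect U ∨
      ∃ V W : Set Pt, IsRect V ∧ IsRect W ∧ closure W ⊆ V ∧ U = V \ closure W)
    (η : ℝ) (hη : 0 < η) :
    ∃ (δ : ℝ) (f : Pt → ℝ), 0 < δ ∧ δ < η ∧
      ContDiff ℝ (⊤ : ℕ∞) f ∧ HasCompactSupport f ∧ (∀ p, f p ∈ Icc (0:ℝ) 1) ∧
      tsupport f = closure U ∧
      (∀ p ∈ U, 0 < f p) ∧
      (∀ p ∈ U, η < Metric.infDist p (frontier U) → f p = 1) ∧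
      (∀ p ∈ U, Metric.infDist p (frontier U) ≤ δ → 0 < Lop f p) := by
  have hne : U ≠ univ := by
    rintro rfl
    have : ((0, 0) : Pt) ∈ Pset := hUP (subset_closure (mem_univ _))
    exact lt_irrefl (0 : ℝ) this
  rcases hshape with ⟨a₁, b₁, a₂, b₂, h₁, h₂, rfl⟩ |
    ⟨V, W, ⟨a₁, b₁, a₂, b₂, h₁, h₂, rfl⟩, ⟨c₁, d₁, c₂, d₂, h₃, h₄, rfl⟩, hWV, rfl⟩
  · have hcl := closure_Ioo_prod_Ioo h₁ h₂
    have ha : 0 < a₂ := by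
      have : ((a₁, a₂) : Pt) ∈ Pset :=
        hUP (hcl ▸ ⟨left_mem_Icc.2 h₁.le, left_mem_Icc.2 h₂.le⟩)
      exact this
    obtain ⟨F, hF, hF01, hF0, hFp, hF1, δ, hδ, hLF⟩ := exists_rect_cutoff h₁ h₂ ha hη
    refine exists_cutoff_of_dist hη (isOpen_Ioo.prod isOpen_Ioo) hne
      (hcl ▸ isCompact_Icc.prod isCompact_Icc) hF hF01 hF0 hFp
      (fun p hp h => hF1 p (mem_shrunk_of_lt_dist hp h))
      ⟨δ, hδ, fun p hp z hz hd => hLF p hp (near_side_of_dist_le hz hd)⟩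
  · have hcl := closure_Ioo_prod_Ioo h₁ h₂
    have hW := closure_Ioo_prod_Ioo h₃ h₄
    rw [hW] at hWV hUP hne ⊢
    have hc := hWV (show ((c₁, c₂) : Pt) ∈ Icc c₁ d₁ ×ˢ Icc c₂ d₂ from
      ⟨left_mem_Icc.2 h₃.le, left_mem_Icc.2 h₄.le⟩)
    have hd := hWV (show ((d₁, d₂) : Pt) ∈ Icc c₁ d₁ ×ˢ Icc c₂ d₂ from
      ⟨right_mem_Icc.2 h₃.le, right_mem_Icc.2 h₄.le⟩)
    obtain ⟨⟨hc1, -⟩, hc2, -⟩ := hc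
    obtain ⟨⟨-, hd1⟩, -, hd2⟩ := hd
    simp only at hc1 hc2 hd1 hd2
    have hWclosed : IsClosed (Icc c₁ d₁ ×ˢ Icc c₂ d₂) := isClosed_Icc.prod isClosed_Icc
    have ha : 0 < a₂ := by
      have hmem : ((a₁, a₂) : Pt) ∈ closure (Ioo a₁ b₁ ×ˢ Ioo a₂ b₂ \ Icc c₁ d₁ ×ˢ Icc c₂ d₂) := by
        rw [sdiff_eq, inter_comm]
        refine hWclosed.isOpen_compl.inter_closure ⟨fun h => ?_, ?_⟩
        · exact absurd h.1.1 (not_le.2 hc1)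
        · exact hcl ▸ ⟨left_mem_Icc.2 h₁.le, left_mem_Icc.2 h₂.le⟩
      exact hUP hmem
    obtain ⟨γ, hγ, g1, g2, g3, g4⟩ : ∃ γ > 0, γ ≤ c₁ - a₁ ∧ γ ≤ b₁ - d₁ ∧ γ ≤ c₂ - a₂ ∧
        γ ≤ b₂ - d₂ :=
      ⟨min (min (c₁ - a₁) (b₁ - d₁)) (min (c₂ - a₂) (b₂ - d₂)),
        lt_min (lt_min (by linarith) (by linarith)) (lt_min (by linarith) (by linarith)),
        (min_le_left _ _).trans (min_le_left _ _), (min_le_left _ _).trans (min_le_right _ _),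
        (min_le_right _ _).trans (min_le_left _ _), (min_le_right _ _).trans (min_le_right _ _)⟩
    obtain ⟨ε, hε, hεη, hεγ⟩ : ∃ ε > 0, ε ≤ η ∧ ε ≤ γ / 2 :=
      ⟨min η (γ / 2), by positivity, min_le_left _ _, min_le_right _ _⟩
    obtain ⟨F, hF, hF01, hF0, hFp, hF1, δF, hδF, hLF⟩ := exists_rect_cutoff h₁ h₂ ha hε
    obtain ⟨G, hG, hG01, hG0, hGp, hG1, δG, hδG, hLG⟩ :=
      exists_rect_excision h₃ h₄ (ha.trans hc2) hε
    refine exists_cutoff_of_dist (f := fun p => F p * G p) hη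
      ((isOpen_Ioo.prod isOpen_Ioo).sdiff hWclosed) hne
      ((isCompact_Icc.prod isCompact_Icc).closure_of_subset
        (sdiff_subset.trans (prod_mono Ioo_subset_Icc_self Ioo_subset_Icc_self)))
      (hF.mul hG) ?_ ?_ ?_ ?_ ?_
    · exact fun p => ⟨mul_nonneg (hF01 _).1 (hG01 _).1,
        mul_le_one₀ (hF01 _).2 (hG01 _).1 (hG01 _).2⟩
    · intro p hp
      by_cases h : p ∈ Ioo a₁ b₁ ×ˢ Ioo a₂ b₂
      · simp [hG0 p (by_contra fun h' => hp ⟨h, h'⟩)]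
      · simp [hF0 p h]
    · exact fun p hp => mul_pos (hFp p hp.1) (hGp p hp.2)
    · intro p hp hfar
      have hFone : F p = 1 := by
        have := mem_shrunk_of_lt_dist hp.1 fun z hz => hfar z fun h => hz h.1
        exact hF1 p ⟨⟨by linarith [this.1.1], by linarith [this.1.2]⟩,
          ⟨by linarith [this.2.1], by linarith [this.2.2]⟩⟩
      have hGone : G p = 1 := by
        refine hG1 p ?_
        by_contra! h
        obtain ⟨he1, he2, he3, he4⟩ := h
        obtain ⟨s, hs, hs'⟩ := exists_mem_Icc_abs_sub_le (t := p.1) h₃.le hη.le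
          (by linarith) (by linarith)
        obtain ⟨t, ht, ht'⟩ := exists_mem_Icc_abs_sub_le (t := p.2) h₄.le hη.le
          (by linarith) (by linarith)
        refine (hfar (s, t) fun h => h.2 ⟨hs, ht⟩).not_ge ?_
        rw [Prod.dist_eq]
        exact max_le hs' ht'
      simp [hFone, hGone]
    · obtain ⟨δ, hδ, l1, l2, l3⟩ : ∃ δ > 0, δ ≤ δF ∧ δ ≤ δG ∧ δ ≤ γ / 4 :=
        ⟨min (min δF δG) (γ / 4), by positivity, (min_le_left _ _).trans (min_le_left _ _),
          (min_le_left _ _).trans (min_le_right _ _), min_le_right _ _⟩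
      refine ⟨δ, hδ, fun p hp z hz hdist => ?_⟩
      by_cases hzV : z ∈ Ioo a₁ b₁ ×ˢ Ioo a₂ b₂
      · have hzW : z ∈ Icc c₁ d₁ ×ˢ Icc c₂ d₂ := by_contra fun h => hz ⟨hzV, h⟩
        obtain ⟨⟨z1, z2⟩, z3, z4⟩ := hzW
        rw [Prod.dist_eq, max_le_iff, Real.dist_eq, Real.dist_eq, abs_le, abs_le] at hdist
        obtain ⟨⟨q1, q2⟩, q3, q4⟩ := hdist
        have hev : (fun p => F p * G p) =ᶠ[𝓝 p] G := by
          have : Ioo (a₁ + ε) (b₁ - ε) ×ˢ Ioo (a₂ + ε) (b₂ - ε) ∈ 𝓝 p :=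
            (isOpen_Ioo.prod isOpen_Ioo).mem_nhds
              ⟨⟨by linarith, by linarith⟩, ⟨by linarith, by linarith⟩⟩
          filter_upwards [this] with q hq
          rw [hF1 q (prod_mono Ioo_subset_Icc_self Ioo_subset_Icc_self hq), one_mul]
        rw [Lop_congr hev]
        exact hLG p ⟨⟨by linarith, by linarith⟩, ⟨by linarith, by linarith⟩⟩ hp.2
      · have hnear := near_side_of_dist_le hzV hdist
        have hopen : IsOpen {q : Pt | q.1 < c₁ - ε ∨ d₁ + ε < q.1 ∨ q.2 < c₂ - ε ∨
            d₂ + ε < q.2} :=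
          (isOpen_lt continuous_fst continuous_const).union
            ((isOpen_lt continuous_const continuous_fst).union
              ((isOpen_lt continuous_snd continuous_const).union
                (isOpen_lt continuous_const continuous_snd)))
        have hev : (fun p => F p * G p) =ᶠ[𝓝 p] F := by
          have hmem : p.1 < c₁ - ε ∨ d₁ + ε < p.1 ∨ p.2 < c₂ - ε ∨ d₂ + ε < p.2 :=
            hnear.imp (fun h => by linarith) (Or.imp (fun h => by linarith)
              (Or.imp (fun h => by linarith) fun h => by linarith))
          filter_upwards [hopen.mem_nhds hmem] with q hq
          rw [hG1 q (hq.imp le_of_lt (Or.imp le_of_lt (Or.imp le_of_lt le_of_lt))), mul_one]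
        rw [Lop_congr hev]
        exact hLF p hp.1 (hnear.imp (fun h => by linarith) (Or.imp (fun h => by linarith)
          (Or.imp (fun h => by linarith) fun h => by linarith)))
end
end
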